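/- Let s ∈ (0,1) and P ∈ (0, ∞). There exist constants c > 0 and δ > 0, depending only on s and P, such that every even, P-periodic, nonconstant solution φ (with wave speed μ) of the steady fKdV equation which is nondecreasing on (−P/2, 0) and satisfies φ(x) ≤ μ for all x, also satisfies: μ − φ(x) ≥ c·|x|^s for all |x| ≤ δ, and μ − φ(−P/2) ≥ c. -/

import Mathlib

open MeasureTheory Set

/-- The Bessel kernel `K_s`. -/
noncomputable def besselKernel (s x : ℝ) : ℝ :=
  (1 / (2 * Real.sqrt Real.pi * Real.Gamma (s / 2))) *
    ∫ t in Set.Ioi (0 : ℝ), Real.exp (-t - x ^ 2 / (4 * t)) * t ^ ((s - 3) / 2)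

/-- A solution of the steady fKdV equation with wave speed `μ`: a bounded continuous
function satisfying the equation pointwise. -/
def IsFKdVSolution (s μ : ℝ) (φ : ℝ → ℝ) : Prop :=
  Continuous φ ∧ (∃ M, ∀ x, |φ x| ≤ M) ∧
    ∀ x, -μ * φ x + (φ x) ^ 2 / 2 + (∫ y, besselKernel s (x - y) * φ y) = 0


/-! ### The Bessel kernel -/

lemma bk_weight_integrable {s b : ℝ} (hs : s ∈ Set.Ioo (0 : ℝ) 1) (hb : 0 < b) :
    IntegrableOn (fun t : ℝ => Real.exp (-(b / t)) * t ^ ((s - 3) / 2)) (Ioi 0) := by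
  have h1 : IntegrableOn (fun x : ℝ => x ^ (-2 - (s - 3) / 2) * Real.exp (-b * x ^ (1 : ℝ)))
      (Ioi 0) := integrableOn_rpow_mul_exp_neg_mul_rpow (by linarith [hs.2]) one_pos hb
  have h2 := (integrableOn_Ioi_comp_rpow_iff' (p := -1) _ (by norm_num)).2 h1
  refine h2.congr_fun ?_ measurableSet_Ioi
  intro t ht
  have ht : 0 < t := ht
  simp only [smul_eq_mul, Real.rpow_one]
  rw [← Real.rpow_mul ht.le, ← mul_assoc, ← Real.rpow_add ht, mul_comm, Real.rpow_neg_one]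
  congr 2
  · ring
  · ring

lemma bk_dom_integrable {s b : ℝ} (hs : s ∈ Set.Ioo (0 : ℝ) 1) (hb : 0 < b) {f : ℝ → ℝ}
    (hf : Measurable f) (h : ∀ t, 0 < t → f t ≤ -(b / t)) :
    IntegrableOn (fun t : ℝ => Real.exp (f t) * t ^ ((s - 3) / 2)) (Ioi 0) := by
  refine Integrable.mono' (bk_weight_integrable hs hb) (by fun_prop) ?_
  refine ae_restrict_of_forall_mem measurableSet_Ioi ?_
  intro t ht
  have ht : 0 < t := ht
  rw [Real.norm_of_nonneg (by positivity)]
  gcongr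
  exact h t ht

lemma bk_const_pos {s : ℝ} (hs : s ∈ Set.Ioo (0 : ℝ) 1) :
    0 < 1 / (2 * Real.sqrt Real.pi * Real.Gamma (s / 2)) := by
  have : 0 < Real.Gamma (s / 2) := Real.Gamma_pos_of_pos (by linarith [hs.1])
  positivity

lemma bk_even (s x : ℝ) : besselKernel s (-x) = besselKernel s x := by
  simp [besselKernel]

/-- scaled form `x ^ (s-1) * E x` -/
lemma bk_scaled {s x : ℝ} (hx : 0 < x) :
    besselKernel s x = (1 / (2 * Real.sqrt Real.pi * Real.Gamma (s / 2))) *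
      (x ^ (s - 1) * ∫ t in Ioi (0 : ℝ),
        Real.exp (-(x ^ 2 * t) - 1 / (4 * t)) * t ^ ((s - 3) / 2)) := by
  unfold besselKernel
  congr 1
  have h := integral_comp_mul_left_Ioi
    (fun t : ℝ => Real.exp (-t - x ^ 2 / (4 * t)) * t ^ ((s - 3) / 2)) 0
    (b := x ^ 2) (by positivity)
  rw [mul_zero, smul_eq_mul, eq_inv_mul_iff_mul_eq₀ (by positivity)] at h
  rw [← h, ← integral_const_mul, ← integral_const_mul]
  refine setIntegral_congr_fun measurableSet_Ioi ?_
  intro t ht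
  have ht : 0 < t := ht
  simp only
  rw [Real.mul_rpow (by positivity) ht.le, ← Real.rpow_natCast x 2, ← Real.rpow_mul hx.le]
  have e1 : x ^ ((2 : ℕ) : ℝ) * t = x ^ 2 * t := by rw [Real.rpow_natCast]
  have e2 : x ^ ((2 : ℕ) : ℝ) / (4 * (x ^ ((2 : ℕ) : ℝ) * t)) = 1 / (4 * t) := by
    field_simp
  rw [e2, e1, mul_left_comm (Real.exp _), ← mul_assoc, ← Real.rpow_add hx]
  congr 2
  push_cast
  ring

/-- form as a mixture of log-convex functions -/
lemma bk_mixture {s x : ℝ} (hx : 0 < x) :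
    besselKernel s x = (1 / (2 * Real.sqrt Real.pi * Real.Gamma (s / 2))) *
      ∫ t in Ioi (0 : ℝ),
        Real.exp ((s - 1) / 2 * Real.log x - x * (t + 1 / (4 * t))) * t ^ ((s - 3) / 2) := by
  unfold besselKernel
  congr 1
  have h := integral_comp_mul_left_Ioi
    (fun t : ℝ => Real.exp (-t - x ^ 2 / (4 * t)) * t ^ ((s - 3) / 2)) 0 (b := x) hx
  rw [mul_zero, smul_eq_mul, eq_inv_mul_iff_mul_eq₀ (by positivity)] at h
  rw [← h, ← integral_const_mul]
  refine setIntegral_congr_fun measurableSet_Ioi ?_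
  intro t ht
  have ht : 0 < t := ht
  simp only
  rw [Real.mul_rpow hx.le ht.le, sub_eq_add_neg ((s - 1) / 2 * Real.log x), Real.exp_add,
    mul_comm ((s - 1) / 2), ← Real.rpow_def_of_pos hx]
  have e : (s - 1) / 2 = 1 + (s - 3) / 2 := by ring
  rw [e, Real.rpow_add hx, Real.rpow_one]
  have e2 : -(x * t) - x ^ 2 / (4 * (x * t)) = -(x * (t + 1 / (4 * t))) := by
    field_simp
    ring
  rw [e2]
  ring

lemma bk_mix_integrable {s x : ℝ} (hs : s ∈ Set.Ioo (0 : ℝ) 1) (hx : 0 < x) :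
    IntegrableOn (fun t : ℝ =>
      Real.exp ((s - 1) / 2 * Real.log x - x * (t + 1 / (4 * t))) * t ^ ((s - 3) / 2))
      (Ioi 0) := by
  have h := bk_dom_integrable (s := s) (b := x / 4) hs (by positivity)
    (f := fun t => - (x * (t + 1 / (4 * t)))) (by fun_prop) (by
      intro t ht
      have : x * (t + 1 / (4 * t)) = x * t + x / 4 / t := by field_simp
      rw [this]
      have : 0 < x * t := by positivity
      linarith)
  refine (h.const_mul (Real.exp ((s - 1) / 2 * Real.log x))).congr ?_
  refine Filter.Eventually.of_forall ?_
  intro t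
  simp only [sub_eq_add_neg _ (x * _), Real.exp_add]
  ring

lemma bk_convex {s : ℝ} (hs : s ∈ Set.Ioo (0 : ℝ) 1) :
    ConvexOn ℝ (Ioi 0) (besselKernel s) := by
  refine ⟨convex_Ioi 0, ?_⟩
  intro x hx y hy a b ha hb hab
  have hx' : 0 < x := hx
  have hy' : 0 < y := hy
  have hz : 0 < a • x + b • y := (convex_Ioi (0 : ℝ)) hx hy ha hb hab
  have hlog := strictConcaveOn_log_Ioi.concaveOn.2 hx hy ha hb hab
  simp only [smul_eq_mul] at *
  rw [bk_mixture hx', bk_mixture hy', bk_mixture hz, mul_left_comm a, mul_left_comm b, ← mul_add]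
  refine mul_le_mul_of_nonneg_left ?_ (bk_const_pos hs).le
  rw [← integral_const_mul, ← integral_const_mul,
    ← integral_add ((bk_mix_integrable hs hx').const_mul a)
      ((bk_mix_integrable hs hy').const_mul b)]
  refine setIntegral_mono_on (bk_mix_integrable hs hz)
    (((bk_mix_integrable hs hx').const_mul a).add ((bk_mix_integrable hs hy').const_mul b))
    measurableSet_Ioi ?_
  intro t ht
  have ht : 0 < t := ht
  rw [← mul_assoc, ← mul_assoc, ← add_mul]
  refine mul_le_mul_of_nonneg_right ?_ (by positivity)
  refine le_trans (Real.exp_le_exp.2 ?_) (convexOn_exp.2 (mem_univ _) (mem_univ _) ha hb hab)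
  simp only [smul_eq_mul]
  have := mul_le_mul_of_nonpos_left hlog (show (s - 1) / 2 ≤ 0 by linarith [hs.2])
  nlinarith

/-- the profile function -/
noncomputable def bkE (s x : ℝ) : ℝ := ∫ t in Ioi (0 : ℝ),
        Real.exp (-(x ^ 2 * t) - 1 / (4 * t)) * t ^ ((s - 3) / 2)

lemma bkE_integrable {s : ℝ} (hs : s ∈ Set.Ioo (0 : ℝ) 1) (x : ℝ) :
    IntegrableOn (fun t : ℝ => Real.exp (-(x ^ 2 * t) - 1 / (4 * t)) * t ^ ((s - 3) / 2))
      (Ioi 0) := by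
  refine bk_dom_integrable (b := 1 / 4) hs (by norm_num) (by fun_prop) ?_
  intro t ht
  have : 0 ≤ x ^ 2 * t := by positivity
  have e : 1 / (4 * t) = 1 / 4 / t := by field_simp
  rw [e]; linarith

lemma bkE_anti {s x y : ℝ} (hs : s ∈ Set.Ioo (0 : ℝ) 1) (hx : 0 ≤ x) (hxy : x ≤ y) :
    bkE s y ≤ bkE s x := by
  refine setIntegral_mono_on (bkE_integrable hs y) (bkE_integrable hs x) measurableSet_Ioi ?_
  intro t ht
  have ht : 0 < t := ht
  gcongr

lemma bkE_pos {s : ℝ} (hs : s ∈ Set.Ioo (0 : ℝ) 1) (x : ℝ) : 0 < bkE s x := by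
  refine (setIntegral_pos_iff_support_of_nonneg_ae ?_ (bkE_integrable hs x)).2 ?_
  · refine ae_restrict_of_forall_mem measurableSet_Ioi ?_
    intro t ht
    have ht : 0 < t := ht
    simp only [Pi.zero_apply]
    positivity
  · have : Ioi (0 : ℝ) ⊆ Function.support
      (fun t : ℝ => Real.exp (-(x ^ 2 * t) - 1 / (4 * t)) * t ^ ((s - 3) / 2)) ∩ Ioi 0 := by
      intro t ht
      have ht' : 0 < t := ht
      refine ⟨?_, ht⟩
      simp only [Function.mem_support]
      positivity
    refine lt_of_lt_of_le ?_ (measure_mono this)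
    simp

lemma bkE_le {s x : ℝ} (hs : s ∈ Set.Ioo (0 : ℝ) 1) :
    bkE s x ≤ Real.exp (-(1 / 2 * x)) *
      ∫ t in Ioi (0 : ℝ), Real.exp (-((1 / 8) / t)) * t ^ ((s - 3) / 2) := by
  rw [← integral_const_mul]
  refine setIntegral_mono_on (bkE_integrable hs x)
    ((bk_weight_integrable hs (by norm_num)).const_mul _) measurableSet_Ioi ?_
  intro t ht
  have ht : 0 < t := ht
  rw [← mul_assoc, ← Real.exp_add]
  gcongr
  have e : 1 / (4 * t) = 1 / 8 / t + 1 / 8 / t := by field_simp; norm_num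
  have : x / 2 ≤ x ^ 2 * t + 1 / 8 / t := by
    have e3 : x ^ 2 * t + 1 / 8 / t - x / 2 = ((x * t - 1 / 4) ^ 2 + 1 / 16) / t := by
      field_simp; ring
    have : 0 ≤ ((x * t - 1 / 4) ^ 2 + 1 / 16) / t := by positivity
    linarith
  rw [e]; linarith

lemma bk_eq {s x : ℝ} (hx : 0 < x) :
    besselKernel s x = (1 / (2 * Real.sqrt Real.pi * Real.Gamma (s / 2))) *
      (x ^ (s - 1) * bkE s x) := bk_scaled hx

lemma bk_pos {s x : ℝ} (hs : s ∈ Set.Ioo (0 : ℝ) 1) (hx : 0 < x) : 0 < besselKernel s x := by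
  rw [bk_eq hx]
  have := bkE_pos hs x
  have := bk_const_pos hs
  positivity

lemma bk_anti {s : ℝ} (hs : s ∈ Set.Ioo (0 : ℝ) 1) : AntitoneOn (besselKernel s) (Ioi 0) := by
  intro x hx y hy hxy
  have hx : 0 < x := hx
  have hy : 0 < y := hy
  rw [bk_eq hx, bk_eq hy]
  have := bkE_pos hs x
  have := bkE_pos hs y
  have := bk_const_pos hs
  have h1 : y ^ (s - 1) ≤ x ^ (s - 1) :=
    Real.rpow_le_rpow_of_nonpos hx hxy (by linarith [hs.2])
  have h2 := bkE_anti hs hx.le hxy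
  gcongr

lemma bk_integrable {s : ℝ} (hs : s ∈ Set.Ioo (0 : ℝ) 1) : Integrable (besselKernel s) := by
  have h0 : IntegrableOn (besselKernel s) (Ioi 0) := by
    have h1 : IntegrableOn (fun x : ℝ => x ^ (s - 1) * Real.exp (-(1 / 2) * x ^ (1 : ℝ)))
      (Ioi 0) := integrableOn_rpow_mul_exp_neg_mul_rpow (by linarith [hs.1]) one_pos (by norm_num)
    refine Integrable.mono' (h1.const_mul
      ((1 / (2 * Real.sqrt Real.pi * Real.Gamma (s / 2))) *
        ∫ t in Ioi (0 : ℝ), Real.exp (-((1 / 8) / t)) * t ^ ((s - 3) / 2)))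
      (aemeasurable_restrict_of_antitoneOn measurableSet_Ioi (bk_anti hs)).aestronglyMeasurable ?_
    refine ae_restrict_of_forall_mem measurableSet_Ioi ?_
    intro x hx
    have hx : 0 < x := hx
    rw [Real.norm_of_nonneg (bk_pos hs hx).le, bk_eq hx, Real.rpow_one,
      mul_assoc (1 / (2 * Real.sqrt Real.pi * Real.Gamma (s / 2)))]
    refine mul_le_mul_of_nonneg_left ?_ (bk_const_pos hs).le
    rw [mul_left_comm]
    refine mul_le_mul_of_nonneg_left ?_ (by positivity)
    refine (bkE_le hs).trans (le_of_eq ?_)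
    rw [mul_comm, neg_mul]
  have h2 : IntegrableOn (besselKernel s) (Iio 0) := by
    have := IntegrableOn.comp_neg_Iio (c := (0 : ℝ)) (f := besselKernel s) (μ := volume)
      (by simpa using h0)
    simpa only [bk_even] using this
  have h3 : IntegrableOn (besselKernel s) (Iic 0) := by
    rwa [integrableOn_Iic_iff_integrableOn_Iio]
  have := h3.union h0
  rwa [Iic_union_Ioi, integrableOn_univ] at this

/-! ### Folding a convolution with an odd periodic function -/

lemma bdd_mul_integrable {k g : ℝ → ℝ} (hk : Integrable k) (hg : Continuous g) {M : ℝ}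
    (hM : ∀ x, |g x| ≤ M) : Integrable (fun y => k y * g y) :=
  hk.mul_bdd (c := M) hg.aestronglyMeasurable (Filter.Eventually.of_forall hM)

lemma fold_eq {k g : ℝ → ℝ} {P x M : ℝ} (hk : Integrable k) (hkP : ∀ z, k (P - z) = k z)
    (hg : Continuous g) (hM : ∀ x, |g x| ≤ M) (godd : ∀ x, g (-x) = -g x)
    (gper : Function.Periodic g P) :
    ∫ z in (0 : ℝ)..P, k z * g (x - z) =
      (∫ y in (0 : ℝ)..x, (k (x - y) - k (x + y)) * g y) +
        ∫ y in x..(P / 2), (k (y - x) - k (x + y)) * g y := by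
  have I0 : Integrable (fun z => k z * g (x - z)) :=
    bdd_mul_integrable hk (by fun_prop) (fun z => hM (x - z))
  have I1 : Integrable (fun y => k (x - y) * g y) :=
    bdd_mul_integrable (hk.comp_sub_left x) hg hM
  have I2 : Integrable (fun y => k (x + y) * g y) :=
    bdd_mul_integrable (hk.comp_add_left x) hg hM
  have I3 : Integrable (fun y => k (y - x) * g y) :=
    bdd_mul_integrable (hk.comp_sub_right x) hg hM
  have e1 : ∫ z in (0 : ℝ)..x, k z * g (x - z) = ∫ y in (0 : ℝ)..x, k (x - y) * g y := by
    have := intervalIntegral.integral_comp_sub_left (a := 0) (b := x)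
      (fun z => k z * g (x - z)) x
    simp only [sub_sub_cancel, sub_self, sub_zero] at this
    exact this.symm
  have e2 : ∫ z in x..(x + P / 2), k z * g (x - z) =
      - ∫ y in (0 : ℝ)..(P / 2), k (x + y) * g y := by
    have := intervalIntegral.integral_comp_add_left (a := 0) (b := P / 2)
      (fun z => k z * g (x - z)) x
    simp only [add_zero] at this
    rw [← this, ← intervalIntegral.integral_neg]
    refine intervalIntegral.integral_congr (fun y _ => ?_)
    rw [show x - (x + y) = -y by ring, godd]
    ring
  have e3 : ∫ z in (x + P / 2)..P, k z * g (x - z) =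
      ∫ y in x..(P / 2), k (y - x) * g y := by
    have := intervalIntegral.integral_comp_sub_left (a := x) (b := P / 2)
      (fun z => k z * g (x - z)) (P + x)
    rw [show P + x - P / 2 = x + P / 2 by ring, show P + x - x = P by ring] at this
    rw [← this]
    refine intervalIntegral.integral_congr (fun y _ => ?_)
    rw [show x - (P + x - y) = y - P by ring, gper.sub_eq,
      show P + x - y = P - (y - x) by ring, hkP]
  have s1 := intervalIntegral.integral_add_adjacent_intervals
    (I0.intervalIntegrable (a := 0) (b := x)) (I0.intervalIntegrable (a := x) (b := x + P / 2))
  have s2 := intervalIntegral.integral_add_adjacent_intervals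
    (I0.intervalIntegrable (a := 0) (b := x + P / 2))
    (I0.intervalIntegrable (a := x + P / 2) (b := P))
  have s3 := intervalIntegral.integral_add_adjacent_intervals
    (I2.intervalIntegrable (a := 0) (b := x)) (I2.intervalIntegrable (a := x) (b := P / 2))
  simp only [sub_mul]
  rw [intervalIntegral.integral_sub I1.intervalIntegrable I2.intervalIntegrable,
    intervalIntegral.integral_sub I3.intervalIntegrable I2.intervalIntegrable]
  linarith

lemma fold_nonneg {k g : ℝ → ℝ} {P x M : ℝ} (hk : Integrable k) (hkP : ∀ z, k (P - z) = k z)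
    (hg : Continuous g) (hM : ∀ x, |g x| ≤ M) (godd : ∀ x, g (-x) = -g x)
    (gper : Function.Periodic g P) (gnn : ∀ y, 0 ≤ y → y ≤ P / 2 → 0 ≤ g y)
    (hmono : ∀ p q, 0 < p → p ≤ q → q ≤ P - p → k q ≤ k p) (hx : 0 ≤ x) (hxP : x ≤ P / 2) :
    0 ≤ ∫ z in (0 : ℝ)..P, k z * g (x - z) := by
  rw [fold_eq hk hkP hg hM godd gper]
  have I1 : Integrable (fun y => (k (x - y) - k (x + y)) * g y) :=
    bdd_mul_integrable ((hk.comp_sub_left x).sub (hk.comp_add_left x)) hg hM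
  have I3 : Integrable (fun y => (k (y - x) - k (x + y)) * g y) :=
    bdd_mul_integrable ((hk.comp_sub_right x).sub (hk.comp_add_left x)) hg hM
  refine add_nonneg ?_ ?_
  · have := intervalIntegral.integral_mono_on_of_le_Ioo hx
      (intervalIntegrable_const (c := (0 : ℝ)) (μ := volume)) I1.intervalIntegrable (by
        intro y hy
        refine mul_nonneg (sub_nonneg.2 (hmono _ _ ?_ ?_ ?_)) (gnn y ?_ ?_) <;>
          linarith [hy.1, hy.2])
    simpa using this
  · have := intervalIntegral.integral_mono_on_of_le_Ioo hxP
      (intervalIntegrable_const (c := (0 : ℝ)) (μ := volume)) I3.intervalIntegrable (by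
        intro y hy
        refine mul_nonneg (sub_nonneg.2 (hmono _ _ ?_ ?_ ?_)) (gnn y ?_ ?_) <;>
          linarith [hy.1, hy.2])
    simpa using this

lemma fold_lower {k g : ℝ → ℝ} {P x M a b : ℝ} (hk : Integrable k)
    (hkP : ∀ z, k (P - z) = k z)
    (hg : Continuous g) (hM : ∀ x, |g x| ≤ M) (godd : ∀ x, g (-x) = -g x)
    (gper : Function.Periodic g P) (gnn : ∀ y, 0 ≤ y → y ≤ P / 2 → 0 ≤ g y)
    (hmono : ∀ p q, 0 < p → p ≤ q → q ≤ P - p → k q ≤ k p)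
    (ha : 0 < a) (hab : a + b ≤ P / 2) (hax : a ≤ x) (hxb : x ≤ b) :
    (k (b - a) - k (2 * a)) * ∫ y in a..b, g y ≤ ∫ z in (0 : ℝ)..P, k z * g (x - z) := by
  rw [fold_eq hk hkP hg hM godd gper]
  have I1 : Integrable (fun y => (k (x - y) - k (x + y)) * g y) :=
    bdd_mul_integrable ((hk.comp_sub_left x).sub (hk.comp_add_left x)) hg hM
  have I3 : Integrable (fun y => (k (y - x) - k (x + y)) * g y) :=
    bdd_mul_integrable ((hk.comp_sub_right x).sub (hk.comp_add_left x)) hg hM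
  have n1 : 0 ≤ ∫ y in (0 : ℝ)..a, (k (x - y) - k (x + y)) * g y := by
    have := intervalIntegral.integral_mono_on_of_le_Ioo ha.le
      (intervalIntegrable_const (c := (0 : ℝ)) (μ := volume)) I1.intervalIntegrable (by
        intro y hy
        refine mul_nonneg (sub_nonneg.2 (hmono _ _ ?_ ?_ ?_)) (gnn y ?_ ?_) <;>
          linarith [hy.1, hy.2])
    simpa using this
  have n2 : 0 ≤ ∫ y in b..(P / 2), (k (y - x) - k (x + y)) * g y := by
    have := intervalIntegral.integral_mono_on_of_le_Ioo (show b ≤ P / 2 by linarith)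
      (intervalIntegrable_const (c := (0 : ℝ)) (μ := volume)) I3.intervalIntegrable (by
        intro y hy
        refine mul_nonneg (sub_nonneg.2 (hmono _ _ ?_ ?_ ?_)) (gnn y ?_ ?_) <;>
          linarith [hy.1, hy.2])
    simpa using this
  have m1 : ∫ y in a..x, (k (b - a) - k (2 * a)) * g y ≤
      ∫ y in a..x, (k (x - y) - k (x + y)) * g y := by
    refine intervalIntegral.integral_mono_on_of_le_Ioo hax
      ((hg.const_mul _).intervalIntegrable _ _) I1.intervalIntegrable ?_
    intro y hy
    refine mul_le_mul_of_nonneg_right (sub_le_sub (hmono _ _ ?_ ?_ ?_) (hmono _ _ ?_ ?_ ?_))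
      (gnn y ?_ ?_) <;> linarith [hy.1, hy.2]
  have m2 : ∫ y in x..b, (k (b - a) - k (2 * a)) * g y ≤
      ∫ y in x..b, (k (y - x) - k (x + y)) * g y := by
    refine intervalIntegral.integral_mono_on_of_le_Ioo hxb
      ((hg.const_mul _).intervalIntegrable _ _) I3.intervalIntegrable ?_
    intro y hy
    refine mul_le_mul_of_nonneg_right (sub_le_sub (hmono _ _ ?_ ?_ ?_) (hmono _ _ ?_ ?_ ?_))
      (gnn y ?_ ?_) <;> linarith [hy.1, hy.2]
  have s1 := intervalIntegral.integral_add_adjacent_intervals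
    (I1.intervalIntegrable (a := 0) (b := a)) (I1.intervalIntegrable (a := a) (b := x))
  have s2 := intervalIntegral.integral_add_adjacent_intervals
    (I3.intervalIntegrable (a := x) (b := b)) (I3.intervalIntegrable (a := b) (b := P / 2))
  have s3 := intervalIntegral.integral_add_adjacent_intervals (μ := volume)
    (hg.intervalIntegrable a x) (hg.intervalIntegrable x b)
  rw [intervalIntegral.integral_const_mul] at m1 m2
  rw [← s3, mul_add]
  linarith

/-- the symmetrised block kernels -/
lemma block_mono {K : ℝ → ℝ} (hc : ConvexOn ℝ (Ioi 0) K) (heven : ∀ x, K (-x) = K x)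
    {P : ℝ} (hP : 0 < P) (n : ℕ) (p q : ℝ) (hp : 0 < p) (hpq : p ≤ q) (hq : q ≤ P - p) :
    K (q + n * P) + K (q - (n + 1) * P) ≤ K (p + n * P) + K (p - (n + 1) * P) := by
  have hn : 0 ≤ (n : ℝ) * P := by positivity
  rw [← heven (q - _), ← heven (p - _)]
  rcases eq_or_lt_of_le hpq with h | h
  · rw [h]
  have hd : 0 < P - 2 * p := by linarith
  obtain ⟨A, hA⟩ : ∃ A, A = p + n * P := ⟨_, rfl⟩
  obtain ⟨B, hB⟩ : ∃ B, B = -(p - (n + 1) * P) := ⟨_, rfl⟩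
  have hA0 : A ∈ Ioi (0 : ℝ) := by simp only [mem_Ioi]; linarith
  have hB0 : B ∈ Ioi (0 : ℝ) := by simp only [mem_Ioi]; linarith
  have hBA : B - A = P - 2 * p := by rw [hA, hB]; ring
  obtain ⟨θ, hθ⟩ : ∃ θ, θ = (q - p) / (P - 2 * p) := ⟨_, rfl⟩
  have hθ0 : 0 ≤ θ := by rw [hθ]; exact div_nonneg (by linarith) hd.le
  have hθ1 : θ ≤ 1 := by rw [hθ, div_le_one hd]; linarith
  have hθm : θ * (B - A) = q - p := by rw [hBA, hθ, div_mul_cancel₀ _ hd.ne']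
  have c1 := hc.2 hA0 hB0 (sub_nonneg.2 hθ1) hθ0 (by ring)
  have c2 := hc.2 hA0 hB0 hθ0 (sub_nonneg.2 hθ1) (by ring)
  simp only [smul_eq_mul] at c1 c2
  rw [show (1 - θ) * A + θ * B = q + n * P by linarith] at c1
  rw [show θ * A + (1 - θ) * B = -(q - (n + 1) * P) by linarith] at c2
  rw [← hA, ← hB]
  linarith

lemma conv_lower {K g : ℝ → ℝ} {P x M a b : ℝ} (hK : Integrable K)
    (hc : ConvexOn ℝ (Ioi 0) K) (heven : ∀ x, K (-x) = K x) (hP : 0 < P)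
    (hg : Continuous g) (hM : ∀ x, |g x| ≤ M) (godd : ∀ x, g (-x) = -g x)
    (gper : Function.Periodic g P) (gnn : ∀ y, 0 ≤ y → y ≤ P / 2 → 0 ≤ g y)
    (ha : 0 < a) (hab : a + b ≤ P / 2) (hax : a ≤ x) (hxb : x ≤ b) :
    ((K (b - a) + K (b - a - P)) - (K (2 * a) + K (2 * a - P))) * ∫ y in a..b, g y ≤
      ∫ z, K z * g (x - z) := by
  have I0 : Integrable (fun z => K z * g (x - z)) :=
    bdd_mul_integrable hK (by fun_prop) (fun z => hM (x - z))
  have hki : ∀ n : ℕ, Integrable (fun z => K (z + n * P) + K (z - (n + 1) * P)) := fun n =>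
    (hK.comp_add_right _).add (hK.comp_sub_right _)
  have hkP : ∀ (n : ℕ) (z : ℝ), K (P - z + n * P) + K (P - z - (n + 1) * P) =
      K (z + n * P) + K (z - (n + 1) * P) := by
    intro n z
    rw [← heven (P - z + n * P), ← heven (P - z - (n + 1) * P), add_comm]
    congr 2 <;> ring
  have step : ∀ n : ℕ, (∫ z in (-((n + 1 : ℕ) * P))..((n + 1 : ℕ) * P), K z * g (x - z)) =
      (∫ z in (-(n * P))..(n * P), K z * g (x - z)) +
        ∫ z in (0 : ℝ)..P, (K (z + n * P) + K (z - (n + 1) * P)) * g (x - z) := by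
    intro n
    have e1 : ∫ z in (n * P)..((n + 1 : ℕ) * P), K z * g (x - z) =
        ∫ z in (0 : ℝ)..P, K (z + n * P) * g (x - z) := by
      have := intervalIntegral.integral_comp_add_right (a := 0) (b := P)
        (fun z => K z * g (x - z)) (n * P)
      rw [zero_add, show P + n * P = (n + 1 : ℕ) * P by push_cast; ring] at this
      rw [← this]
      refine intervalIntegral.integral_congr (fun y _ => ?_)
      rw [show x - (y + n * P) = x - y - n * P by ring, gper.sub_nat_mul_eq]
    have e2 : ∫ z in (-((n + 1 : ℕ) * P))..(-(n * P)), K z * g (x - z) =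
        ∫ z in (0 : ℝ)..P, K (z - (n + 1) * P) * g (x - z) := by
      have := intervalIntegral.integral_comp_sub_right (a := 0) (b := P)
        (fun z => K z * g (x - z)) ((n + 1 : ℕ) * P)
      rw [zero_sub, show P - (n + 1 : ℕ) * P = -(n * P) by push_cast; ring] at this
      rw [← this]
      refine intervalIntegral.integral_congr (fun y _ => ?_)
      rw [show x - (y - (n + 1 : ℕ) * P) = x - y + (n + 1 : ℕ) * P by ring, gper.nat_mul (n + 1)]
      push_cast
      rfl
    have s1 := intervalIntegral.integral_add_adjacent_intervals
      (I0.intervalIntegrable (a := -((n + 1 : ℕ) * P)) (b := -(n * P)))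
      (I0.intervalIntegrable (a := -(n * P)) (b := n * P))
    have s2 := intervalIntegral.integral_add_adjacent_intervals
      (I0.intervalIntegrable (a := -((n + 1 : ℕ) * P)) (b := n * P))
      (I0.intervalIntegrable (a := n * P) (b := (n + 1 : ℕ) * P))
    have J1 : Integrable (fun z => K (z + n * P) * g (x - z)) :=
      bdd_mul_integrable (hK.comp_add_right _) (by fun_prop) (fun z => hM (x - z))
    have J2 : Integrable (fun z => K (z - (n + 1) * P) * g (x - z)) :=
      bdd_mul_integrable (hK.comp_sub_right _) (by fun_prop) (fun z => hM (x - z))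
    simp only [add_mul (K _)]
    rw [intervalIntegral.integral_add J1.intervalIntegrable J2.intervalIntegrable]
    linarith
  have h0 := fold_lower (hki 0) (hkP 0) hg hM godd gper gnn (block_mono hc heven hP 0)
    ha hab hax hxb
  have hlow : ∀ n : ℕ, ((K (b - a) + K (b - a - P)) - (K (2 * a) + K (2 * a - P))) *
      (∫ y in a..b, g y) ≤ ∫ z in (-((n + 1 : ℕ) * P))..((n + 1 : ℕ) * P), K z * g (x - z) := by
    intro n
    induction n with
    | zero =>
      rw [step 0]
      simpa using h0
    | succ m ih =>
      rw [step (m + 1)]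
      have := fold_nonneg (x := x) (hki (m + 1)) (hkP (m + 1)) hg hM godd gper gnn
        (block_mono hc heven hP (m + 1)) (by linarith) (by linarith)
      linarith
  have hT : Filter.Tendsto (fun n : ℕ => ((n + 1 : ℕ) : ℝ) * P) Filter.atTop Filter.atTop :=
    Filter.Tendsto.atTop_mul_const hP
      (tendsto_natCast_atTop_atTop.comp (Filter.tendsto_add_atTop_nat 1))
  have := intervalIntegral_tendsto_integral I0 (Filter.tendsto_neg_atTop_atBot.comp hT) hT
  exact ge_of_tendsto' this hlow

/-! ### Lower bounds for the kernel -/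

lemma rpow_blowup {s : ℝ} (hs : s ∈ Set.Ioo (0 : ℝ) 1) (R : ℝ) {η : ℝ} (hη : 0 < η) :
    ∃ δ, 0 < δ ∧ δ ≤ η ∧ ∀ X, 0 < X → X ≤ δ → R ≤ X ^ (s - 1) := by
  have hm : 0 < max R 1 := lt_of_lt_of_le one_pos (le_max_right _ _)
  have hs1 : s - 1 < 0 := by linarith [hs.2]
  refine ⟨min η ((max R 1) ^ (1 / (s - 1))), lt_min hη (by positivity), min_le_left _ _, ?_⟩
  intro X hX hXd
  have h1 : X ≤ (max R 1) ^ (1 / (s - 1)) := hXd.trans (min_le_right _ _)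
  have h2 := Real.rpow_le_rpow_of_nonpos hX h1 hs1.le
  rw [← Real.rpow_mul hm.le, one_div_mul_cancel hs1.ne, Real.rpow_one] at h2
  exact (le_max_left _ _).trans h2

lemma kernel_lower {s P : ℝ} (hs : s ∈ Set.Ioo (0 : ℝ) 1) (hP : 0 < P) :
    ∃ c δ : ℝ, 0 < c ∧ 0 < δ ∧ δ ≤ P / 2 ∧ ∀ X, 0 < X → X ≤ δ →
      c * X ^ (s - 1) ≤ (besselKernel s (X / 4) + besselKernel s (X / 4 - P)) -
        (besselKernel s (X / 2) + besselKernel s (X / 2 - P)) := by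
  obtain ⟨C, hC⟩ : ∃ C, C = 1 / (2 * Real.sqrt Real.pi * Real.Gamma (s / 2)) := ⟨_, rfl⟩
  have hC0 : 0 < C := hC ▸ bk_const_pos hs
  obtain ⟨d, hd⟩ : ∃ d, d = (1 / 4 : ℝ) ^ (s - 1) - (1 / 2 : ℝ) ^ (s - 1) := ⟨_, rfl⟩
  have hd0 : 0 < d := by
    rw [hd, sub_pos]
    exact Real.rpow_lt_rpow_of_neg (by norm_num) (by norm_num) (by linarith [hs.2])
  have hE := bkE_pos hs P
  obtain ⟨c, hc⟩ : ∃ c, c = C * (d * bkE s P) := ⟨_, rfl⟩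
  have hc0 : 0 < c := by rw [hc]; positivity
  obtain ⟨δ, hδ, hδP, hb⟩ := rpow_blowup hs (2 * besselKernel s (P / 2) / c)
    (show 0 < P / 2 by linarith)
  refine ⟨c / 2, δ, by positivity, hδ, hδP, ?_⟩
  intro X hX hXδ
  have h1 := hb X hX hXδ
  rw [div_le_iff₀ hc0] at h1
  have hXP : X ≤ P / 2 := hXδ.trans hδP
  have h2 : besselKernel s (X / 2 - P) ≤ besselKernel s (P / 2) := by
    rw [← bk_even]
    refine bk_anti hs ?_ ?_ ?_ <;> try simp only [mem_Ioi]
    all_goals linarith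
  have h3 : 0 < besselKernel s (X / 4 - P) := by
    rw [← bk_even]
    exact bk_pos hs (by linarith)
  have h4 : c * X ^ (s - 1) ≤ besselKernel s (X / 4) - besselKernel s (X / 2) := by
    rw [bk_eq (show 0 < X / 4 by linarith), bk_eq (show 0 < X / 2 by linarith), ← hC, ← mul_sub,
      hc, mul_assoc]
    refine mul_le_mul_of_nonneg_left ?_ hC0.le
    have e1 : (X / 4) ^ (s - 1) = (1 / 4 : ℝ) ^ (s - 1) * X ^ (s - 1) := by
      rw [← Real.mul_rpow (by norm_num) hX.le]; congr 1; ring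
    have e2 : (X / 2) ^ (s - 1) = (1 / 2 : ℝ) ^ (s - 1) * X ^ (s - 1) := by
      rw [← Real.mul_rpow (by norm_num) hX.le]; congr 1; ring
    have a1 : bkE s (X / 2) ≤ bkE s (X / 4) := bkE_anti hs (by linarith) (by linarith)
    have a2 : bkE s P ≤ bkE s (X / 2) := bkE_anti hs (by linarith) (by linarith)
    have hXp : 0 < X ^ (s - 1) := by positivity
    calc d * bkE s P * X ^ (s - 1) = (d * X ^ (s - 1)) * bkE s P := by ring
      _ ≤ (d * X ^ (s - 1)) * bkE s (X / 2) := by gcongr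
      _ = (X / 4) ^ (s - 1) * bkE s (X / 2) - (X / 2) ^ (s - 1) * bkE s (X / 2) := by
        rw [e1, e2, hd]; ring
      _ ≤ (X / 4) ^ (s - 1) * bkE s (X / 4) - (X / 2) ^ (s - 1) * bkE s (X / 2) := by
        gcongr
  linarith

lemma kernel_blowup {s P : ℝ} (hs : s ∈ Set.Ioo (0 : ℝ) 1) (hP : 0 < P) (R : ℝ) {η : ℝ}
    (hη : 0 < η) (hηP : η < P) :
    ∃ ε, 0 < ε ∧ ε ≤ η ∧ R < besselKernel s ε + besselKernel s (ε - P) := by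
  have hC0 := bk_const_pos hs
  have hE := bkE_pos hs P
  obtain ⟨δ, hδ, hδη, hb⟩ := rpow_blowup hs
    (R / ((1 / (2 * Real.sqrt Real.pi * Real.Gamma (s / 2))) * bkE s P)) hη
  refine ⟨δ, hδ, hδη, ?_⟩
  have h1 := hb δ hδ le_rfl
  rw [div_le_iff₀ (by positivity)] at h1
  have h3 : 0 < besselKernel s (δ - P) := by
    rw [← bk_even]
    exact bk_pos hs (by linarith)
  have h2 : bkE s P ≤ bkE s δ := bkE_anti hs hδ.le (by linarith)
  have h4 : δ ^ (s - 1) * (1 / (2 * Real.sqrt Real.pi * Real.Gamma (s / 2)) * bkE s P) ≤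
      besselKernel s δ := by
    rw [bk_eq hδ, mul_left_comm]
    gcongr
  linarith

/-! ### The difference inequality for solutions -/

/-- Properties of `u = μ - φ`. -/
structure WaveU (s P : ℝ) (u : ℝ → ℝ) : Prop where
  cont : Continuous u
  bdd : ∃ M, ∀ x, |u x| ≤ M
  even : ∀ x, u (-x) = u x
  per : Function.Periodic u P
  nonneg : ∀ x, 0 ≤ u x
  mono : ∀ x y, 0 ≤ x → x ≤ y → y ≤ P / 2 → u x ≤ u y
  noncon : ∃ x y, u x ≠ u y
  eqn : ∀ x y, u x ^ 2 - u y ^ 2 = 2 * ∫ z, besselKernel s z * (u (x - z) - u (y - z))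

lemma mono_closure {φ : ℝ → ℝ} {a b : ℝ} (hφ : Continuous φ)
    (h : MonotoneOn φ (Ioo a b)) : ∀ x y, a ≤ x → x ≤ y → y ≤ b → φ x ≤ φ y := by
  intro x y hax hxy hyb
  rcases eq_or_lt_of_le hxy with e | hlt
  · rw [e]
  have key : ∀ p q, x < p → p < q → q < y → φ p ≤ φ q := fun p q h1 h2 h3 =>
    h ⟨by linarith, by linarith⟩ ⟨by linarith, by linarith⟩ h2.le
  have k1 : ∀ q, x < q → q < y → φ x ≤ φ q := by
    intro q h1 h2
    refine le_of_tendsto ((hφ.tendsto x).mono_left (nhdsWithin_le_nhds (s := Ioi x))) ?_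
    filter_upwards [Ioo_mem_nhdsGT h1] with p hp using key p q hp.1 hp.2 h2
  refine ge_of_tendsto ((hφ.tendsto y).mono_left (nhdsWithin_le_nhds (s := Iio y))) ?_
  filter_upwards [Ioo_mem_nhdsLT hlt] with q hq using k1 q hq.1 hq.2

lemma waveU_of_solution {s P μ : ℝ} {φ : ℝ → ℝ} (hs : s ∈ Set.Ioo (0 : ℝ) 1)
    (hsol : IsFKdVSolution s μ φ) (heven : ∀ x, φ (-x) = φ x)
    (hper : Function.Periodic φ P) (hnc : ∃ x y, φ x ≠ φ y)
    (hmono : MonotoneOn φ (Set.Ioo (-(P / 2)) 0)) (hle : ∀ x, φ x ≤ μ) :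
    WaveU s P (fun x => μ - φ x) := by
  obtain ⟨hc, ⟨M, hM⟩, heq⟩ := hsol
  refine ⟨by fun_prop, ⟨|μ| + M, fun x => (abs_sub _ _).trans (by linarith [hM x])⟩, ?_, ?_, ?_,
    ?_, ?_, ?_⟩
  · intro x; simp only [heven]
  · intro x; simp only [hper x]
  · intro x; linarith [hle x]
  · intro x y hx hxy hy
    have := mono_closure hc hmono (-y) (-x) (by linarith) (by linarith) (by linarith)
    rw [heven, heven] at this
    linarith
  · obtain ⟨x, y, hxy⟩ := hnc
    exact ⟨x, y, fun h => hxy (by linarith)⟩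
  · intro x y
    have conv : ∀ x, ∫ y, besselKernel s (x - y) * φ y = ∫ z, besselKernel s z * φ (x - z) := by
      intro x
      have := integral_sub_left_eq_self (fun y => besselKernel s (x - y) * φ y) volume x
      rw [← this]
      simp only [sub_sub_cancel]
    have I : ∀ x, Integrable (fun z => besselKernel s z * φ (x - z)) := fun x =>
      bdd_mul_integrable (bk_integrable hs) (by fun_prop) (fun z => hM (x - z))
    have e : ∫ z, besselKernel s z * ((μ - φ (x - z)) - (μ - φ (y - z))) =
        (∫ z, besselKernel s z * φ (y - z)) - ∫ z, besselKernel s z * φ (x - z) := by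
      rw [← integral_sub (I y) (I x)]
      congr 1
      ext z
      ring
    rw [e]
    have h1 := heq x
    have h2 := heq y
    rw [conv] at h1 h2
    nlinarith

lemma WaveU.diff_nonneg {s P : ℝ} {u : ℝ → ℝ} (hu : WaveU s P u) {h y : ℝ}
    (hh : 0 ≤ h) (hhP : h ≤ P / 2) (hy : 0 ≤ y) (hyP : y ≤ P / 2) :
    0 ≤ u (y + h) - u (y - h) := by
  have e1 : u (y - h) = u |y - h| := by
    rcases abs_cases (y - h) with ⟨h1, _⟩ | ⟨h1, _⟩
    · rw [h1]
    · rw [h1, hu.even]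
  have a1 : |y - h| ≤ y + h := abs_le.2 ⟨by linarith, by linarith⟩
  have a2 : |y - h| ≤ P - (y + h) := abs_le.2 ⟨by linarith, by linarith⟩
  rw [e1, sub_nonneg]
  rcases le_total (y + h) (P / 2) with h2 | h2
  · exact hu.mono _ _ (abs_nonneg _) a1 h2
  · have e2 : u (y + h) = u (P - (y + h)) := by
      rw [← hu.even (P - (y + h)), show -(P - (y + h)) = y + h - P by ring, hu.per.sub_eq]
    rw [e2]
    exact hu.mono _ _ (abs_nonneg _) a2 (by linarith)

lemma WaveU.lower {s P : ℝ} {u : ℝ → ℝ} (hu : WaveU s P u) (hs : s ∈ Set.Ioo (0 : ℝ) 1)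
    (hP : 0 < P) {h a b x : ℝ} (hh : 0 ≤ h) (hhP : h ≤ P / 2)
    (ha : 0 < a) (hab : a + b ≤ P / 2) (hax : a ≤ x) (hxb : x ≤ b) :
    2 * (((besselKernel s (b - a) + besselKernel s (b - a - P)) -
      (besselKernel s (2 * a) + besselKernel s (2 * a - P))) *
        ∫ y in a..b, (u (y + h) - u (y - h))) ≤ u (x + h) ^ 2 - u (x - h) ^ 2 := by
  obtain ⟨M, hM⟩ := hu.bdd
  have hc := hu.cont
  rw [hu.eqn]
  have := conv_lower (g := fun y => u (y + h) - u (y - h)) (M := M + M) (bk_integrable hs)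
    (bk_convex hs) (bk_even s) hP
    (by fun_prop) (fun y => (abs_sub _ _).trans (add_le_add (hM _) (hM _)))
    (by
      intro y
      rw [← hu.even (-y + h), ← hu.even (-y - h), show -(-y + h) = y - h by ring,
        show -(-y - h) = y + h by ring]
      ring)
    (by
      intro y
      simp only
      rw [show y + P + h = y + h + P by ring, show y + P - h = y - h + P by ring, hu.per, hu.per])
    (fun y h1 h2 => hu.diff_nonneg hh hhP h1 h2) ha hab hax hxb
  have e : ∀ z, (u (x + h - z) - u (x - h - z)) = u (x - z + h) - u (x - z - h) := by
    intro z
    rw [show x + h - z = x - z + h by ring, show x - h - z = x - z - h by ring]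
  simp only [e]
  linarith

/-- An interval integral of a nonnegative continuous function with a positive value. -/
lemma integral_pos_of {g : ℝ → ℝ} (hg : Continuous g) {a b c : ℝ} (hab : a < b)
    (hnn : ∀ y, a ≤ y → y ≤ b → 0 ≤ g y) (hca : a ≤ c) (hcb : c ≤ b) (hc : 0 < g c) :
    0 < ∫ y in a..b, g y :=
  intervalIntegral.integral_pos hab hg.continuousOn (fun y hy => hnn y hy.1.le hy.2)
    ⟨c, ⟨hca, hcb⟩, hc⟩

lemma WaveU.ext {s P : ℝ} {u : ℝ → ℝ} (hu : WaveU s P u) (hs : s ∈ Set.Ioo (0 : ℝ) 1)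
    (hP : 0 < P) {r : ℝ} (hr : 0 < r) (hrP : r < P / 2) (hur : u r = u 0) :
    ∃ r', r < r' ∧ r' ≤ P / 2 ∧ u r' = u 0 := by
  have hc := hu.cont
  obtain ⟨ε, hε, hεη, hk⟩ := kernel_blowup hs hP
    (besselKernel s (2 * (r / 2)) + besselKernel s (2 * (r / 2) - P))
    (η := min r (P / 2 - r)) (lt_min hr (by linarith))
    (lt_of_le_of_lt (min_le_left _ _) (by linarith))
  have hε1 : ε ≤ r := hεη.trans (min_le_left _ _)
  have hε2 : ε ≤ P / 2 - r := hεη.trans (min_le_right _ _)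
  refine ⟨r + ε, by linarith, by linarith, ?_⟩
  by_contra hne
  have hge : u 0 ≤ u (r + ε) := hu.mono _ _ le_rfl (by linarith) (by linarith)
  have hue : u ε = u 0 := le_antisymm (hur ▸ hu.mono _ _ hε.le hε1 hrP.le)
    (hu.mono _ _ le_rfl hε.le (by linarith))
  have hlow := hu.lower hs hP (h := r / 2) (a := r / 2) (b := r / 2 + ε) (x := r / 2)
    (by linarith) (by linarith) (by linarith) (by linarith) le_rfl (by linarith)
  rw [add_halves, sub_self, hur, sub_self, add_sub_cancel_left] at hlow
  have hpos : 0 < ∫ y in (r / 2)..(r / 2 + ε), (u (y + r / 2) - u (y - r / 2)) := by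
    refine integral_pos_of (c := r / 2 + ε) (by fun_prop) (by linarith) ?_ (by linarith) le_rfl ?_
    · intro y h1 h2
      exact hu.diff_nonneg (by linarith) (by linarith) (by linarith) (by linarith)
    · rw [show r / 2 + ε + r / 2 = r + ε by ring, add_sub_cancel_left, hue, sub_pos]
      exact lt_of_le_of_ne hge (Ne.symm hne)
  have := mul_pos (sub_pos.2 hk) hpos
  linarith

lemma WaveU.const_of {s P : ℝ} {u : ℝ → ℝ} (hu : WaveU s P u) (hP : 0 < P)
    (h : u (P / 2) = u 0) : False := by
  have key : ∀ x, u x = u 0 := by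
    intro x
    obtain ⟨y, hy, hxy⟩ := hu.per.exists_mem_Ico hP x (-(P / 2))
    rw [hxy]
    have e1 : u y = u |y| := by
      rcases abs_cases y with ⟨h1, _⟩ | ⟨h1, _⟩
      · rw [h1]
      · rw [h1, hu.even]
    have a1 : |y| ≤ P / 2 := abs_le.2 ⟨by linarith [hy.1], by linarith [hy.2]⟩
    rw [e1]
    exact le_antisymm (h ▸ hu.mono _ _ (abs_nonneg y) a1 le_rfl)
      (hu.mono _ _ le_rfl (abs_nonneg y) a1)
  obtain ⟨x, y, hxy⟩ := hu.noncon
  exact hxy (by rw [key x, key y])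

lemma WaveU.strict {s P : ℝ} {u : ℝ → ℝ} (hu : WaveU s P u) (hs : s ∈ Set.Ioo (0 : ℝ) 1)
    (hP : 0 < P) {r : ℝ} (hr : 0 < r) (hrP : r ≤ P / 2) : u 0 < u r := by
  refine lt_of_le_of_ne (hu.mono _ _ le_rfl hr.le hrP) ?_
  intro hur
  have hcomp : IsCompact (Icc r (P / 2) ∩ u ⁻¹' {u 0}) :=
    isCompact_Icc.inter_right (isClosed_singleton.preimage hu.cont)
  obtain ⟨m, ⟨hm, hmu⟩, hmax⟩ := hcomp.exists_isGreatest ⟨r, ⟨le_rfl, hrP⟩, hur.symm⟩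
  have hmu : u m = u 0 := hmu
  rcases eq_or_lt_of_le hm.2 with e | hlt
  · exact hu.const_of hP (e ▸ hmu)
  · obtain ⟨r', h1, h2, h3⟩ := hu.ext hs hP (lt_of_lt_of_le hr hm.1) hlt hmu
    have := hmax ⟨⟨hm.1.trans h1.le, h2⟩, h3⟩
    linarith

lemma WaveU.main {s P : ℝ} {u : ℝ → ℝ} (hu : WaveU s P u) (hs : s ∈ Set.Ioo (0 : ℝ) 1)
    (hP : 0 < P) {X : ℝ} (hX : 0 < X) (hXP : X ≤ P / 2) :
    ((besselKernel s (X / 4) + besselKernel s (X / 4 - P)) -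
      (besselKernel s (X / 2) + besselKernel s (X / 2 - P))) * (X / 4) ≤ u X := by
  have hc := hu.cont
  obtain ⟨L, hL⟩ : ∃ L, L = ((besselKernel s (X / 4) + besselKernel s (X / 4 - P)) -
      (besselKernel s (X / 2) + besselKernel s (X / 2 - P))) := ⟨_, rfl⟩
  obtain ⟨I, hI⟩ : ∃ I, I = ∫ y in (X / 4)..(X / 2), (u (y + X / 4) - u (y - X / 4)) := ⟨_, rfl⟩
  have hpos : 0 < I := by
    rw [hI]
    refine integral_pos_of (c := X / 4) (by fun_prop) (by linarith) ?_ le_rfl (by linarith) ?_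
    · intro y h1 h2
      exact hu.diff_nonneg (by linarith) (by linarith) (by linarith) (by linarith)
    · rw [sub_self, sub_pos]
      exact hu.strict hs hP (by linarith) (by linarith)
  rw [← hL]
  have pt : ∀ x ∈ Icc (X / 4) (X / 2), L * I ≤ u X * (u (x + X / 4) - u (x - X / 4)) := by
    intro x hx
    have hlow := hu.lower hs hP (h := X / 4) (a := X / 4) (b := X / 2) (x := x)
      (by linarith) (by linarith) (by linarith) (by linarith) hx.1 hx.2
    rw [show X / 2 - X / 4 = X / 4 by ring, show 2 * (X / 4) = X / 2 by ring, ← hL, ← hI] at hlow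
    have d := hu.diff_nonneg (h := X / 4) (y := x) (by linarith) (by linarith)
      (by linarith [hx.1]) (by linarith [hx.2])
    have b1 : u (x + X / 4) ≤ u X :=
      hu.mono _ _ (by linarith [hx.1]) (by linarith [hx.2]) hXP
    have b2 : u (x - X / 4) ≤ u X := by linarith
    nlinarith
  have hint := intervalIntegral.integral_mono_on (show X / 4 ≤ X / 2 by linarith)
    (intervalIntegrable_const (c := L * I) (μ := volume))
    ((show Continuous fun x => u X * (u (x + X / 4) - u (x - X / 4)) by
      fun_prop).intervalIntegrable _ _) pt
  rw [intervalIntegral.integral_const, intervalIntegral.integral_const_mul, ← hI,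
    smul_eq_mul, ← mul_assoc] at hint
  have := le_of_mul_le_mul_right hint hpos
  linarith

/-- Uniform lower bounds for the distance of monotone fKdV waves to the wave speed. -/
theorem fKdV_uniform_lower_bounds (s P : ℝ) (hs : s ∈ Set.Ioo (0 : ℝ) 1) (hP : 0 < P) :
    ∃ c δ : ℝ, 0 < c ∧ 0 < δ ∧
      ∀ (μ : ℝ) (φ : ℝ → ℝ), IsFKdVSolution s μ φ → (∀ x, φ (-x) = φ x) →
        Function.Periodic φ P → (∃ x y, φ x ≠ φ y) →
        MonotoneOn φ (Set.Ioo (-(P / 2)) 0) → (∀ x, φ x ≤ μ) →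
        (∀ x : ℝ, |x| ≤ δ → c * |x| ^ s ≤ μ - φ x) ∧ c ≤ μ - φ (-(P / 2)) := by
  obtain ⟨c, δ, hc, hδ, hδP, hk⟩ := kernel_lower hs hP
  refine ⟨min (c / 4) (c / 4 * δ ^ s), δ, lt_min (by positivity) (by positivity), hδ, ?_⟩
  intro μ φ hsol heven hper hnc hmono hle
  have hu := waveU_of_solution hs hsol heven hper hnc hmono hle
  have hX : ∀ X, 0 < X → X ≤ δ → c / 4 * X ^ s ≤ μ - φ X := by
    intro X hX hXδ
    refine le_trans ?_ (hu.main hs hP hX (hXδ.trans hδP))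
    have h1 := mul_le_mul_of_nonneg_right (hk X hX hXδ) (show 0 ≤ X / 4 by linarith)
    refine le_trans (le_of_eq ?_) h1
    have : X ^ s = X ^ (s - 1) * X := by
      rw [← Real.rpow_add_one hX.ne', sub_add_cancel]
    rw [this]; ring
  constructor
  · intro x hx
    rcases eq_or_ne x 0 with rfl | hx0
    · rw [abs_zero, Real.zero_rpow hs.1.ne', mul_zero]
      exact hu.nonneg 0
    · have h1 := hX |x| (abs_pos.2 hx0) hx
      have h2 : φ |x| = φ x := by
        rcases abs_cases x with ⟨h1, _⟩ | ⟨h1, _⟩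
        · rw [h1]
        · rw [h1, heven]
      rw [h2] at h1
      exact (mul_le_mul_of_nonneg_right (min_le_left _ _) (by positivity)).trans h1
  · rw [heven]
    exact (min_le_right _ _).trans ((hX δ hδ le_rfl).trans (hu.mono δ (P / 2) hδ.le hδP le_rfl))
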